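/- Let n ≥ 4. Then φ ∘ ι_n = φ as maps from O_n to U_n, i.e., φ(ι_n(a,b,c,d)) = φ(a,b,c,d) for every (a,b,c,d) ∈ O_n. -/

import Mathlib

/-- ε_{a,b}(c): 0 if c < a, 1 if a < c < b, 2 if b < c (for c ∉ {a,b}, a < b). -/
def eps (a b c : ℕ) : ℕ := if c < a then 0 else if c < b then 1 else 2

/-- ρ^n_{i,j} : sends i ↦ n−1, j ↦ n, and k ↦ k − ε_{i,j}(k) otherwise. -/
def rho (n i j k : ℕ) : ℕ := if k = i then n - 1 else if k = j then n else k - eps i j k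

/-- The inverse of ρ^n_{i,j} on {1,...,n}. -/
noncomputable def rhoInv (n i j c : ℕ) : ℕ := Function.invFunOn (rho n i j) (Set.Icc 1 n) c

/-- ρ^n_{i,j} extended by the identity outside {1,...,n}, viewed as a map ℕ → ℕ. -/
def rhoE (n i j k : ℕ) : ℕ := if 1 ≤ k ∧ k ≤ n then rho n i j k else k

/-- A map ℕ → ℕ which restricts to a permutation of S and is the identity off S. -/
def PermOn (S : Set ℕ) (f : ℕ → ℕ) : Prop := Set.BijOn f S S ∧ ∀ x ∉ S, f x = x

/-- Membership in O_n: 1 ≤ a < b ≤ n and 1 ≤ c < d ≤ n−2. -/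
def memO (n a b c d : ℕ) : Prop := 1 ≤ a ∧ a < b ∧ b ≤ n ∧ 1 ≤ c ∧ c < d ∧ d ≤ n - 2

/-- The involution ι_n on O_n: ι_n(a,b,c,d) = (k, l, ρ_{k,l}(a), ρ_{k,l}(b)) where
k = ρ_{a,b}⁻¹(c), l = ρ_{a,b}⁻¹(d). -/
noncomputable def iota (n : ℕ) (t : ℕ × ℕ × ℕ × ℕ) : ℕ × ℕ × ℕ × ℕ :=
  (rhoInv n t.1 t.2.1 t.2.2.1, rhoInv n t.1 t.2.1 t.2.2.2,
    rho n (rhoInv n t.1 t.2.1 t.2.2.1) (rhoInv n t.1 t.2.1 t.2.2.2) t.1,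
    rho n (rhoInv n t.1 t.2.1 t.2.2.1) (rhoInv n t.1 t.2.1 t.2.2.2) t.2.1)

/-- The generating relations for the equivalence defining U_n:
(i,j,k,l) ~ (j,i,k,l), (i,j,k,l) ~ (i,j,l,k), (i,j,k,l) ~ (k,l,i,j). -/
inductive URel : ℕ × ℕ × ℕ × ℕ → ℕ × ℕ × ℕ × ℕ → Prop
  | swapFirst (i j k l : ℕ) : URel (i, j, k, l) (j, i, k, l)
  | swapSecond (i j k l : ℕ) : URel (i, j, k, l) (i, j, l, k)
  | exchange (i j k l : ℕ) : URel (i, j, k, l) (k, l, i, j)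

/-- t is a 4-tuple of pairwise distinct elements of {1,...,n}. -/
def distinct4 (n : ℕ) (t : ℕ × ℕ × ℕ × ℕ) : Prop :=
  (t.1 ∈ Set.Icc 1 n) ∧ (t.2.1 ∈ Set.Icc 1 n) ∧ (t.2.2.1 ∈ Set.Icc 1 n) ∧
    (t.2.2.2 ∈ Set.Icc 1 n) ∧
  t.1 ≠ t.2.1 ∧ t.1 ≠ t.2.2.1 ∧ t.1 ≠ t.2.2.2 ∧
    t.2.1 ≠ t.2.2.1 ∧ t.2.1 ≠ t.2.2.2 ∧ t.2.2.1 ≠ t.2.2.2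

/-- The representative of φ(a,b,c,d) ∈ U_n, namely (a, b, ρ_{a,b}⁻¹(c), ρ_{a,b}⁻¹(d));
φ itself is the class of this tuple modulo the equivalence generated by URel. -/
noncomputable def phiRep (n : ℕ) (t : ℕ × ℕ × ℕ × ℕ) : ℕ × ℕ × ℕ × ℕ :=
  (t.1, t.2.1, rhoInv n t.1 t.2.1 t.2.2.1, rhoInv n t.1 t.2.1 t.2.2.2)

theorem rho_injOn {n i j : ℕ} (hi : 1 ≤ i) (hij : i < j) (hj : j ≤ n) :
    Set.InjOn (rho n i j) (Set.Icc 1 n) := by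
  rintro x ⟨hx1, hxn⟩ y ⟨hy1, hyn⟩ hxy
  unfold rho eps at hxy
  split_ifs at hxy <;> omega

theorem rhoInv_rho {n i j k : ℕ} (hi : 1 ≤ i) (hij : i < j) (hj : j ≤ n) (hk : k ∈ Set.Icc 1 n) :
    rhoInv n i j (rho n i j k) = k :=
  (rho_injOn hi hij hj).leftInvOn_invFunOn hk

theorem rhoInv_eq_ite {n i j c : ℕ} (hi : 1 ≤ i) (hij : i < j) (hj : j ≤ n)
    (hc : 1 ≤ c) (hcn : c ≤ n - 2) :
    rhoInv n i j c = if c < i then c else if c + 1 < j then c + 1 else c + 2 := by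
  set k := if c < i then c else if c + 1 < j then c + 1 else c + 2 with hk
  have hkn : k ∈ Set.Icc 1 n := by
    rw [Set.mem_Icc]
    split_ifs at hk <;> omega
  have hrho : rho n i j k = c := by
    unfold rho eps
    split_ifs at hk ⊢ <;> omega
  rw [← rhoInv_rho hi hij hj hkn, hrho]

/-- φ ∘ ι_n = φ : O_n → U_n, i.e. the defining representatives of
φ(ι_n(a,b,c,d)) and φ(a,b,c,d) are identified in the quotient U_n. -/
theorem stmt9 (n : ℕ) (hn : 4 ≤ n) (a b c d : ℕ) (h : memO n a b c d) :
    Relation.EqvGen URel (phiRep n (iota n (a, b, c, d))) (phiRep n (a, b, c, d)) := by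
  obtain ⟨ha, hab, hb, hc, hcd, hd⟩ := h
  have hk := rhoInv_eq_ite ha hab hb hc (by omega : c ≤ n - 2)
  have hl := rhoInv_eq_ite ha hab hb (by omega : 1 ≤ d) hd
  simp only [phiRep, iota]
  generalize rhoInv n a b c = k at hk ⊢
  generalize rhoInv n a b d = l at hl ⊢
  have hk1 : 1 ≤ k := by split_ifs at hk <;> omega
  have hkl : k < l := by split_ifs at hk hl <;> omega
  have hln : l ≤ n := by split_ifs at hl <;> omega
  rw [rhoInv_rho hk1 hkl hln ⟨ha, by omega⟩, rhoInv_rho hk1 hkl hln ⟨by omega, hb⟩]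
  exact .rel _ _ (.exchange k l a b)
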